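/- arXiv:1412.8563 — 2 statements merged into one kernel-verified Lean document; each statement's English description precedes it below -/
import Mathlib

section
/- Let X ∈ ℝ^{n×p} and y ∈ ℝⁿ be fixed. Define the weighted least-squares map β(θ) = (X'Diag(θ)X)^{-1} X'Diag(θ)y on the open set U ⊆ ℝⁿ of weight vectors θ for which X'Diag(θ)X is invertible. Then β is differentiable on U, and its derivative at θ ∈ U, viewed as a p×n matrix (the gradient ∇β(θ) with respect to θ), equals (X'Diag(θ)X)^{-1} X' Diag(y − Xβ(θ)). -/
open MeasureTheory ProbabilityTheory Matrix

theorem wols_cont {n p : ℕ} (X : Matrix (Fin n) (Fin p) ℝ) :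
    Continuous (fun w : Fin n → ℝ => Xᵀ * Matrix.diagonal w * X) :=
  (continuous_const.matrix_mul (continuous_id.matrix_diagonal)).matrix_mul continuous_const

theorem wols_isOpen {n p : ℕ} (X : Matrix (Fin n) (Fin p) ℝ) :
    IsOpen {θ : Fin n → ℝ | IsUnit (Xᵀ * Matrix.diagonal θ * X)} := by
  simp only [Matrix.isUnit_iff_isUnit_det, isUnit_iff_ne_zero]
  exact isOpen_ne_fun (wols_cont X).matrix_det continuous_const

theorem wols_inv {n p : ℕ} (X : Matrix (Fin n) (Fin p) ℝ) (θ : Fin n → ℝ)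
    (h : IsUnit (Xᵀ * Matrix.diagonal θ * X)) :
    ContinuousAt (fun w : Fin n → ℝ => (Xᵀ * Matrix.diagonal w * X)⁻¹) θ := by
  simp only [Matrix.inv_def, Ring.inverse_eq_inv']
  refine ContinuousAt.smul (ContinuousAt.inv₀ (wols_cont X).matrix_det.continuousAt ?_)
    (wols_cont X).matrix_adjugate.continuousAt
  exact isUnit_iff_ne_zero.mp ((Matrix.isUnit_iff_isUnit_det _).mp h)

theorem wols_diff {n p : ℕ} (X : Matrix (Fin n) (Fin p) ℝ) (y θ w : Fin n → ℝ)
    (b : Fin p → ℝ)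
    (hb : (Xᵀ * Matrix.diagonal θ * X) *ᵥ b = (Xᵀ * Matrix.diagonal θ) *ᵥ y)
    (hw : IsUnit (Xᵀ * Matrix.diagonal w * X)) :
    ((Xᵀ * Matrix.diagonal w * X)⁻¹ * Xᵀ * Matrix.diagonal w) *ᵥ y - b =
      ((Xᵀ * Matrix.diagonal w * X)⁻¹ * Xᵀ * Matrix.diagonal (y - X *ᵥ b)) *ᵥ (w - θ) := by
  have hd := (Matrix.isUnit_iff_isUnit_det _).mp hw
  have e1 : b = (Xᵀ * Matrix.diagonal w * X)⁻¹ *ᵥ ((Xᵀ * Matrix.diagonal w * X) *ᵥ b) := by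
    rw [Matrix.mulVec_mulVec, Matrix.nonsing_inv_mul _ hd, Matrix.one_mulVec]
  have e2 : Matrix.diagonal (y - X *ᵥ b) *ᵥ (w - θ) =
      Matrix.diagonal w *ᵥ y - Matrix.diagonal w *ᵥ (X *ᵥ b)
        - (Matrix.diagonal θ *ᵥ y - Matrix.diagonal θ *ᵥ (X *ᵥ b)) := by
    ext i
    simp only [Matrix.mulVec_diagonal, Pi.sub_apply]
    ring
  conv_lhs => rw [e1]
  simp only [← Matrix.mulVec_mulVec] at hb ⊢
  rw [e2]
  simp only [Matrix.mulVec_sub, hb]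
  simp

attribute [local instance] Matrix.linftyOpNormedAddCommGroup in
theorem wols_littleO {n p : ℕ} (M : (Fin n → ℝ) → Matrix (Fin p) (Fin n) ℝ) (θ : Fin n → ℝ)
    (hM : ContinuousAt M θ) :
    (fun w => (M w - M θ) *ᵥ (w - θ)) =o[nhds θ] fun w => w - θ := by
  have h0 : Filter.Tendsto (fun w => ‖M w - M θ‖) (nhds θ) (nhds 0) := by
    exact tendsto_iff_norm_sub_tendsto_zero.mp hM
  rw [Asymptotics.isLittleO_iff]
  intro c hc
  filter_upwards [h0.eventually (gt_mem_nhds hc)] with w hw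
  exact (Matrix.linfty_opNorm_mulVec _ _).trans (by gcongr)

/-- The weighted least-squares map `β(θ) = (X'Diag(θ)X)⁻¹ X'Diag(θ) y` is differentiable on
the open set of weights `θ` where `X'Diag(θ)X` is invertible, with `p × n` gradient matrix
`(X'Diag(θ)X)⁻¹ X' Diag(y − Xβ(θ))`. -/
theorem weighted_ols_gradient
    (n p : ℕ) (X : Matrix (Fin n) (Fin p) ℝ) (y : Fin n → ℝ) :
    IsOpen {θ : Fin n → ℝ | IsUnit (Xᵀ * Matrix.diagonal θ * X)} ∧
      ∀ θ : Fin n → ℝ, IsUnit (Xᵀ * Matrix.diagonal θ * X) →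
        HasFDerivAt
          (fun w : Fin n → ℝ =>
            ((Xᵀ * Matrix.diagonal w * X)⁻¹ * Xᵀ * Matrix.diagonal w).mulVec y)
          (LinearMap.toContinuousLinearMap
            (Matrix.mulVecLin
              ((Xᵀ * Matrix.diagonal θ * X)⁻¹ * Xᵀ *
                Matrix.diagonal
                  (y - X.mulVec
                    (((Xᵀ * Matrix.diagonal θ * X)⁻¹ * Xᵀ * Matrix.diagonal θ).mulVec y)))))
          θ := by
  refine ⟨wols_isOpen X, fun θ h => ?_⟩
  have hd := (Matrix.isUnit_iff_isUnit_det _).mp h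
  set b := ((Xᵀ * Matrix.diagonal θ * X)⁻¹ * Xᵀ * Matrix.diagonal θ).mulVec y with hbdef
  have hb : (Xᵀ * Matrix.diagonal θ * X) *ᵥ b = (Xᵀ * Matrix.diagonal θ) *ᵥ y := by
    rw [hbdef, Matrix.mulVec_mulVec, Matrix.mul_assoc _⁻¹, Matrix.mul_nonsing_inv_cancel_left _ _ hd]
  have hM : ContinuousAt (fun w : Fin n → ℝ =>
      (Xᵀ * Matrix.diagonal w * X)⁻¹ * Xᵀ * Matrix.diagonal (y - X *ᵥ b)) θ := by
    have hc : Continuous (fun N : Matrix (Fin p) (Fin p) ℝ =>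
        N * Xᵀ * Matrix.diagonal (y - X *ᵥ b)) :=
      (continuous_id.matrix_mul continuous_const).matrix_mul continuous_const
    exact hc.continuousAt.comp (wols_inv X θ h)
  refine HasFDerivAt.of_isLittleO ((wols_littleO _ θ hM).congr' ?_ Filter.EventuallyEq.rfl)
  filter_upwards [(wols_isOpen X).mem_nhds h] with w hw
  rw [← hbdef, wols_diff X y θ w b hb hw, Matrix.sub_mulVec]
  rfl
end

section
/- Let X ∈ ℝ^{n×p} and y ∈ ℝⁿ with X'X invertible, let b = (X'X)^{-1}X'y be the OLS coefficients and r = y − Xb the residual vector. Then the weighted least-squares map β(θ) = (X'Diag(θ)X)^{-1}X'Diag(θ)y is differentiable at the all-ones vector θ = 𝟙, with β(𝟙) = b and gradient ∇β(𝟙) = (X'X)^{-1}X'Diag(r) (a p×n matrix). -/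
open MeasureTheory ProbabilityTheory Matrix

/-- At the all-ones weight vector, the weighted least-squares map `β(θ)` equals the OLS
coefficients `b = (X'X)⁻¹X'y` and has gradient `(X'X)⁻¹ X' Diag(r)` with `r = y − Xb`. -/
theorem weighted_ols_gradient_at_ones
    (n p : ℕ) (X : Matrix (Fin n) (Fin p) ℝ) (y : Fin n → ℝ)
    (hinv : IsUnit (Xᵀ * X)) :
    ((Xᵀ * Matrix.diagonal (fun _ : Fin n => (1 : ℝ)) * X)⁻¹ * Xᵀ *
        Matrix.diagonal (fun _ : Fin n => (1 : ℝ))).mulVec y =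
      ((Xᵀ * X)⁻¹ * Xᵀ).mulVec y ∧
      HasFDerivAt
        (fun w : Fin n → ℝ =>
          ((Xᵀ * Matrix.diagonal w * X)⁻¹ * Xᵀ * Matrix.diagonal w).mulVec y)
        (LinearMap.toContinuousLinearMap
          (Matrix.mulVecLin
            ((Xᵀ * X)⁻¹ * Xᵀ *
              Matrix.diagonal (y - X.mulVec (((Xᵀ * X)⁻¹ * Xᵀ).mulVec y)))))
        (fun _ : Fin n => (1 : ℝ)) := by
  have hone : (Matrix.diagonal (fun _ : Fin n => (1 : ℝ))) = 1 := Matrix.diagonal_one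
  have hdet : IsUnit (Xᵀ * X).det := (Matrix.isUnit_iff_isUnit_det _).1 hinv
  refine ⟨by simp only [hone, Matrix.mul_one], ?_⟩
  set b : Fin p → ℝ := ((Xᵀ * X)⁻¹ * Xᵀ).mulVec y with hb
  set r : Fin n → ℝ := y - X.mulVec b with hr
  have hXr : Xᵀ *ᵥ r = 0 := by
    rw [hr, Matrix.mulVec_sub, hb, Matrix.mulVec_mulVec, Matrix.mulVec_mulVec,
      ← Matrix.mul_assoc, Matrix.mul_nonsing_inv _ hdet, Matrix.one_mul, sub_self]
  have hA : Continuous (fun w : Fin n → ℝ => Xᵀ * Matrix.diagonal w * X) := by fun_prop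
  have hA1 : Xᵀ * Matrix.diagonal (fun _ : Fin n => (1 : ℝ)) * X = Xᵀ * X := by
    rw [hone, Matrix.mul_one]
  have hdetc : Continuous (fun w : Fin n → ℝ => (Xᵀ * Matrix.diagonal w * X).det) :=
    hA.matrix_det
  have hev : ∀ᶠ w in nhds (fun _ : Fin n => (1 : ℝ)),
      (Xᵀ * Matrix.diagonal w * X).det ≠ 0 := by
    apply hdetc.continuousAt.eventually_ne
    rw [hA1]; exact hdet.ne_zero
  have hK : ContinuousAt (fun w : Fin n → ℝ =>
      (Xᵀ * Matrix.diagonal w * X)⁻¹ * Xᵀ * Matrix.diagonal r) (fun _ => 1) := by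
    have h1 : ContinuousAt (fun w : Fin n → ℝ => (Xᵀ * Matrix.diagonal w * X)⁻¹)
        (fun _ => 1) := by
      simp only [Matrix.inv_def, Ring.inverse_eq_inv']
      refine ContinuousAt.smul (hdetc.continuousAt.inv₀ ?_) hA.matrix_adjugate.continuousAt
      rw [hA1]; exact hdet.ne_zero
    have h2 : Continuous (fun M : Matrix (Fin p) (Fin p) ℝ => M * Xᵀ * Matrix.diagonal r) := by
      fun_prop
    exact h2.continuousAt.comp h1
  rw [hasFDerivAt_iff_isLittleO]
  have key : ∀ᶠ w in nhds (fun _ : Fin n => (1 : ℝ)),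
      ((((Xᵀ * Matrix.diagonal w * X)⁻¹ * Xᵀ * Matrix.diagonal r)
        - ((Xᵀ * X)⁻¹ * Xᵀ * Matrix.diagonal r)) *ᵥ (w - fun _ => 1)) =
      ((Xᵀ * Matrix.diagonal w * X)⁻¹ * Xᵀ * Matrix.diagonal w).mulVec y
       - ((Xᵀ * Matrix.diagonal (fun _ : Fin n => (1 : ℝ)) * X)⁻¹ * Xᵀ *
          Matrix.diagonal (fun _ : Fin n => (1 : ℝ))).mulVec y
       - (LinearMap.toContinuousLinearMap
          (Matrix.mulVecLin ((Xᵀ * X)⁻¹ * Xᵀ * Matrix.diagonal r))) (w - fun _ => 1) := by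
    filter_upwards [hev] with w hw
    have hu : IsUnit (Xᵀ * Matrix.diagonal w * X).det := isUnit_iff_ne_zero.2 hw
    rw [Matrix.sub_mulVec]
    simp only [LinearMap.coe_toContinuousLinearMap', Matrix.mulVecLin_apply]
    congr 1
    rw [hA1, hone, Matrix.mul_one, ← hb]
    have e1 : Matrix.diagonal r *ᵥ (w - fun _ => 1) = Matrix.diagonal w *ᵥ r - r := by
      ext i
      simp only [Matrix.mulVec_diagonal, Pi.sub_apply]
      ring
    have e2 : b = (Xᵀ * Matrix.diagonal w * X)⁻¹ *ᵥ ((Xᵀ * Matrix.diagonal w * X) *ᵥ b) := by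
      rw [Matrix.mulVec_mulVec, Matrix.nonsing_inv_mul _ hu, Matrix.one_mulVec]
    rw [← Matrix.mulVec_mulVec, e1, Matrix.mulVec_sub, ← Matrix.mulVec_mulVec r, hXr,
      Matrix.mulVec_zero, sub_zero]
    conv_rhs => rw [e2]
    rw [hr]
    simp only [Matrix.mulVec_sub, Matrix.mulVec_mulVec, Matrix.mul_assoc]
  refine Asymptotics.IsLittleO.congr' ?_ key Filter.EventuallyEq.rfl
  rw [Asymptotics.isLittleO_pi]
  intro i
  simp only [Matrix.mulVec, dotProduct]
  refine Asymptotics.IsLittleO.fun_sum fun j _ => ?_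
  have ho : (fun w : Fin n → ℝ => (((Xᵀ * Matrix.diagonal w * X)⁻¹ * Xᵀ * Matrix.diagonal r)
        - ((Xᵀ * X)⁻¹ * Xᵀ * Matrix.diagonal r)) i j)
      =o[nhds (fun _ => 1)] (fun _ => (1 : ℝ)) := by
    rw [Asymptotics.isLittleO_one_iff]
    have h3 : Filter.Tendsto (fun w : Fin n → ℝ =>
        ((Xᵀ * Matrix.diagonal w * X)⁻¹ * Xᵀ * Matrix.diagonal r) i j) (nhds (fun _ => 1))
        (nhds (((Xᵀ * X)⁻¹ * Xᵀ * Matrix.diagonal r) i j)) := by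
      have h5 := hK.tendsto
      rw [hA1] at h5
      exact (tendsto_pi_nhds.1 ((tendsto_pi_nhds.1 h5) i)) j
    have h4 := h3.sub_const (((Xᵀ * X)⁻¹ * Xᵀ * Matrix.diagonal r) i j)
    rw [sub_self] at h4
    exact h4
  have hO : (fun w : Fin n → ℝ => (w - (fun _ => 1 : Fin n → ℝ)) j)
      =O[nhds (fun _ => 1)] (fun w : Fin n → ℝ => ‖w - (fun _ => 1 : Fin n → ℝ)‖) :=
    Asymptotics.IsBigO.of_bound 1 (Filter.Eventually.of_forall fun w => by
      simpa using norm_le_pi_norm (w - (fun _ => 1 : Fin n → ℝ)) j)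
  have := ho.mul_isBigO hO
  simp only [one_mul] at this
  exact this.of_norm_right
end
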